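/- For every natural number k ≥ 1 and every real number x > 0, one has (k−1+x)·(k−1)!·f_k(x) < x^k. -/

import Mathlib

/-- The signed tail of the Taylor series of `e^{-x}`:
`f k x = (-1)^k ∑_{j=k}^∞ (-x)^j / j!`. -/
noncomputable def f (k : ℕ) (x : ℝ) : ℝ :=
  (-1 : ℝ) ^ k * ∑' j : ℕ, (-x) ^ (k + j) / (Nat.factorial (k + j))

theorem f_zero_eq (x : ℝ) : f 0 x = Real.exp (-x) := by
  simp [f, Real.exp_eq_exp_ℝ, NormedSpace.exp_eq_tsum_div]

theorem f_rec (k : ℕ) (x : ℝ) : f (k + 1) x = x ^ k / (Nat.factorial k) - f k x := by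
  have hs : Summable (fun j : ℕ => (-x) ^ (k + j) / (Nat.factorial (k + j) : ℝ)) := by
    have := (summable_nat_add_iff k).2 (Real.summable_pow_div_factorial (-x))
    simpa [add_comm] using this
  have h1 : ((-1 : ℝ)) ^ k * (-x) ^ k = x ^ k := by
    rw [← mul_pow]; simp
  have h2 : (fun j : ℕ => (-x) ^ (k + (j + 1)) / (Nat.factorial (k + (j + 1)) : ℝ)) =
      fun j : ℕ => (-x) ^ (k + 1 + j) / (Nat.factorial (k + 1 + j) : ℝ) := by
    funext j
    rw [show k + (j + 1) = k + 1 + j by ring]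
  unfold f
  rw [hs.tsum_eq_zero_add, h2, add_zero]
  rw [← h1]
  ring

theorem f_deriv (k : ℕ) (x : ℝ) : HasDerivAt (f (k + 1)) (f k x) x := by
  induction k generalizing x with
  | zero =>
    have e : f (0 + 1) = fun x => 1 - Real.exp (-x) := by
      funext y; rw [f_rec, f_zero_eq]; simp
    rw [e, f_zero_eq]
    have := ((hasDerivAt_neg x).exp).const_sub 1
    simpa using this
  | succ k ih =>
    have e : f (k + 1 + 1) = fun x => x ^ (k + 1) / (Nat.factorial (k + 1)) - f (k + 1) x := by
      funext y; rw [f_rec]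
    rw [e, f_rec k x]
    have := ((hasDerivAt_pow (k + 1) x).div_const (Nat.factorial (k + 1) : ℝ)).sub (ih x)
    refine HasDerivAt.congr_deriv this ?_
    have : (Nat.factorial k : ℝ) ≠ 0 := by positivity
    rw [Nat.factorial_succ]
    push_cast
    field_simp

theorem f_at_zero (k : ℕ) : f (k + 1) 0 = 0 := by
  simp [f]

theorem h_pos (k : ℕ) (x : ℝ) (hx : 0 < x) : 0 < x * f k x - k * f (k + 1) x := by
  induction k generalizing x with
  | zero => rw [f_zero_eq]; simp; positivity
  | succ k ih =>
    have hd : ∀ y : ℝ, HasDerivAt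
        (fun x => x * f (k + 1) x - ((k + 1 : ℕ) : ℝ) * f (k + 1 + 1) x)
        (y * f k y - k * f (k + 1) y) y := by
      intro y
      have := ((hasDerivAt_id y).mul (f_deriv k y)).sub
        ((f_deriv (k + 1) y).const_mul ((k + 1 : ℕ) : ℝ))
      refine HasDerivAt.congr_deriv this ?_
      simp only [id]
      push_cast
      ring
    have hm := strictMonoOn_of_deriv_pos (convex_Ici (0 : ℝ))
      (fun y _ => (hd y).continuousAt.continuousWithinAt)
      (fun y hy => by
        rw [interior_Ici] at hy
        rw [(hd y).deriv]
        exact ih y hy)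
    have := hm (Set.mem_Ici.2 le_rfl) (Set.mem_Ici.2 hx.le) hx
    simpa [f_at_zero] using this

theorem stmt_5 (k : ℕ) (hk : 1 ≤ k) (x : ℝ) (hx : 0 < x) :
    ((k : ℝ) - 1 + x) * (Nat.factorial (k - 1)) * f k x < x ^ k := by
  obtain ⟨m, rfl⟩ : ∃ m, k = m + 1 := ⟨k - 1, by omega⟩
  have h := h_pos m x hx
  have hf : (0 : ℝ) < Nat.factorial m := by positivity
  have hr := f_rec m x
  have e : x ^ m = (Nat.factorial m) * (f (m + 1) x + f m x) := by
    rw [hr]; field_simp; ring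
  simp only [Nat.add_sub_cancel]
  rw [pow_succ, e]
  push_cast
  nlinarith [mul_pos hf h]
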